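/- (τ1-method inclusion sets, Theorem 1.3) For every ε ≥ 0 and every n ∈ {1, …, N−1}, there holds the two-sided inclusion Spec_ε A ⊆ Γ^n_ε(A) ⊆ Spec_{ε+ε''_n(A)+2‖C‖} A; in particular Spec A ⊆ Γ^n_0(A) ⊆ Spec_{ε''_n(A)+2‖C‖} A. -/

import Mathlib

open scoped Real

noncomputable section

namespace SpecIncl

/-- The smallest singular value of a (possibly rectangular) complex matrix,
as the infimum of `‖F x‖` over the unit sphere. -/
noncomputable def sval {ι κ : Type*} [Fintype ι] [Fintype κ] [DecidableEq κ]
    (F : Matrix ι κ ℂ) : ℝ :=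
  sInf {y : ℝ | ∃ x : EuclideanSpace ℂ κ, ‖x‖ = 1 ∧ y = ‖Matrix.toEuclideanLin F x‖}

/-- The spectral norm (2-norm) of a complex matrix. -/
noncomputable def opNorm {ι κ : Type*} [Fintype ι] [Fintype κ] [DecidableEq κ]
    (F : Matrix ι κ ℂ) : ℝ :=
  sSup {y : ℝ | ∃ x : EuclideanSpace ℂ κ, ‖x‖ = 1 ∧ y = ‖Matrix.toEuclideanLin F x‖}

/-- The closed ε-pseudospectrum of a square complex matrix. -/
noncomputable def pspec {ι : Type*} [Fintype ι] [DecidableEq ι] (ε : ℝ)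
    (E : Matrix ι ι ℂ) : Set ℂ :=
  {z : ℂ | sval (E - z • (1 : Matrix ι ι ℂ)) ≤ ε}

/-- Assemble blocks into a block matrix indexed by a sigma type. -/
def blockMat {N : ℕ} (m : Fin N → ℕ)
    (a : ∀ i j : Fin N, Matrix (Fin (m i)) (Fin (m j)) ℂ) :
    Matrix ((i : Fin N) × Fin (m i)) ((j : Fin N) × Fin (m j)) ℂ :=
  fun p q => a p.1 q.1 p.2 q.2

/-- The block-tridiagonal part of a block matrix. -/
def triPart {N : ℕ} {m : Fin N → ℕ}
    (a : ∀ i j : Fin N, Matrix (Fin (m i)) (Fin (m j)) ℂ) :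
    ∀ i j : Fin N, Matrix (Fin (m i)) (Fin (m j)) ℂ :=
  fun i j => if |(i : ℤ) - (j : ℤ)| ≤ 1 then a i j else 0

/-- The remaining (off-tridiagonal) part of a block matrix. -/
def remPart {N : ℕ} {m : Fin N → ℕ}
    (a : ∀ i j : Fin N, Matrix (Fin (m i)) (Fin (m j)) ℂ) :
    ∀ i j : Fin N, Matrix (Fin (m i)) (Fin (m j)) ℂ :=
  fun i j => if |(i : ℤ) - (j : ℤ)| ≤ 1 then 0 else a i j

/-- r_L(A): max of the norms of the first-subdiagonal blocks. -/
noncomputable def rL {N : ℕ} {m : Fin N → ℕ}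
    (a : ∀ i j : Fin N, Matrix (Fin (m i)) (Fin (m j)) ℂ) : ℝ :=
  sSup {y : ℝ | ∃ i j : Fin N, (j : ℕ) + 1 = (i : ℕ) ∧ y = opNorm (a i j)}

/-- r_U(A): max of the norms of the first-superdiagonal blocks. -/
noncomputable def rU {N : ℕ} {m : Fin N → ℕ}
    (a : ∀ i j : Fin N, Matrix (Fin (m i)) (Fin (m j)) ℂ) : ℝ :=
  sSup {y : ℝ | ∃ i j : Fin N, (i : ℕ) + 1 = (j : ℕ) ∧ y = opNorm (a i j)}

noncomputable def rA {N : ℕ} {m : Fin N → ℕ}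
    (a : ∀ i j : Fin N, Matrix (Fin (m i)) (Fin (m j)) ℂ) : ℝ :=
  rL a + rU a

/-- θ_n for the coefficient `c = r_L r_U / r²`: the unique solution of
`2 sin(t/2) cos((n+1/2)t) + c sin((n−1)t) = 0` in `[π/(2n+1), π/(n+2)]`
(by uniqueness, equal to the infimum of the solution set). -/
noncomputable def theta (c : ℝ) (n : ℕ) : ℝ :=
  sInf {t : ℝ | t ∈ Set.Icc (Real.pi / (2 * (n : ℝ) + 1)) (Real.pi / ((n : ℝ) + 2)) ∧
    2 * Real.sin (t / 2) * Real.cos (((n : ℝ) + 1 / 2) * t)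
      + c * Real.sin (((n : ℝ) - 1) * t) = 0}

/-- ε_n(A) := 2 r(A) sin(θ_n(A)/2) + ‖C‖. -/
noncomputable def epsTau {N : ℕ} {m : Fin N → ℕ}
    (a : ∀ i j : Fin N, Matrix (Fin (m i)) (Fin (m j)) ℂ) (n : ℕ) : ℝ :=
  2 * rA a * Real.sin (theta (rL a * rU a / (rA a) ^ 2) n / 2)
    + opNorm (blockMat m (remPart a))

/-- The index `k + i` in `Fin N` (0-based window of length `n` starting at `k`). -/
def widx {N n k : ℕ} (h : k + n ≤ N) (i : Fin n) : Fin N :=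
  ⟨k + i, by have := i.isLt; omega⟩

/-- The principal submatrix `B_{n,k}` of a block matrix, with block rows and
columns `k+1,…,k+n` (1-based), i.e. `k,…,k+n-1` (0-based). -/
def window {N : ℕ} {m : Fin N → ℕ}
    (b : ∀ i j : Fin N, Matrix (Fin (m i)) (Fin (m j)) ℂ)
    (n k : ℕ) (h : k + n ≤ N) :
    Matrix ((i : Fin n) × Fin (m (widx h i))) ((j : Fin n) × Fin (m (widx h j))) ℂ :=
  fun p q => b (widx h p.1) (widx h q.1) p.2 q.2

/-- σ^n_ε(A) of the τ-method. -/
noncomputable def sigmaLow {N : ℕ} {m : Fin N → ℕ}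
    (a : ∀ i j : Fin N, Matrix (Fin (m i)) (Fin (m j)) ℂ)
    (n : ℕ) (h : n ≤ N) (ε : ℝ) : Set ℂ :=
  (⋃ k : Fin (N - n + 1),
      pspec (ε + epsTau a n)
        (window (triPart a) n k (by have := k.isLt; omega))) ∪
  (⋃ m' : Fin (n - 1),
      pspec (ε + epsTau a n)
        (window (triPart a) (m' + 1) 0 (by have := m'.isLt; omega)) ∪
      pspec (ε + epsTau a n)
        (window (triPart a) (m' + 1) (N - (m' + 1)) (by have := m'.isLt; omega)))

/-- σ̂^n_ε(A) of the τ-method. -/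
noncomputable def sigmaHat {N : ℕ} {m : Fin N → ℕ}
    (a : ∀ i j : Fin N, Matrix (Fin (m i)) (Fin (m j)) ℂ)
    (n : ℕ) (h : n ≤ N) (ε : ℝ) : Set ℂ :=
  ⋃ k : Fin (N - n + 1),
    pspec (ε + epsTau a (n - 2))
      (window (triPart a) n k (by have := k.isLt; omega))

/-- The τ-method inclusion set Σ^n_ε(A). -/
noncomputable def SigmaTau {N : ℕ} {m : Fin N → ℕ}
    (a : ∀ i j : Fin N, Matrix (Fin (m i)) (Fin (m j)) ℂ)
    (n : ℕ) (h : n ≤ N) (ε : ℝ) : Set ℂ :=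
  if n ≤ 2 then sigmaLow a n h ε else sigmaLow a n h ε ∩ sigmaHat a n h ε


/-- The row size of the extended block structure: `m i` for `0 ≤ i < N`
(0-based), and `1` (the paper's `1 × m` zero-block convention) otherwise. -/
def rsz {N : ℕ} (m : Fin N → ℕ) (i : ℤ) : ℕ :=
  if h : 0 ≤ i ∧ i < N then m ⟨i.toNat, by omega⟩ else 1

/-- Scalar access to a block matrix extended by zeros outside the index
range `{0,…,N−1}` (0-based). -/
noncomputable def sb {N : ℕ} {m : Fin N → ℕ}
    (b : ∀ i j : Fin N, Matrix (Fin (m i)) (Fin (m j)) ℂ)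
    (i j : ℤ) (α β : ℕ) : ℂ :=
  if hi : 0 ≤ i ∧ i < N then
    if hj : 0 ≤ j ∧ j < N then
      if hα : α < m ⟨i.toNat, by omega⟩ then
        if hβ : β < m ⟨j.toNat, by omega⟩ then
          b ⟨i.toNat, by omega⟩ ⟨j.toNat, by omega⟩ ⟨α, hα⟩ ⟨β, hβ⟩
        else 0
      else 0
    else 0
  else 0

/-- The rectangular one-sided truncation `B^+_{n,k}`: the `(n+2) × n` block
matrix with first block row `(b_{k,k+1}, 0, …, 0)`, middle part `B_{n,k}`, and
last block row `(0, …, 0, b_{k+n+1,k+n})` (1-based indices as in the paper). -/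
noncomputable def Bplus {N : ℕ} {m : Fin N → ℕ}
    (b : ∀ i j : Fin N, Matrix (Fin (m i)) (Fin (m j)) ℂ)
    (n k : ℕ) (h : k + n ≤ N) :
    Matrix ((i : Fin (n + 2)) × Fin (rsz m ((k : ℤ) - 1 + i)))
      ((j : Fin n) × Fin (m (widx h j))) ℂ :=
  fun p q => sb b ((k : ℤ) - 1 + p.1) ((k : ℤ) + q.1) p.2 q.2

/-- The rectangular matrix `I⁺_n` whose middle `n × n` block part is the
identity and whose first and last block rows are zero. -/
noncomputable def IplusMat {N : ℕ} (m : Fin N → ℕ)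
    (n k : ℕ) (h : k + n ≤ N) :
    Matrix ((i : Fin (n + 2)) × Fin (rsz m ((k : ℤ) - 1 + i)))
      ((j : Fin n) × Fin (m (widx h j))) ℂ :=
  fun p q => if (p.1 : ℕ) = (q.1 : ℕ) + 1 ∧ (p.2 : ℕ) = (q.2 : ℕ) then 1 else 0

/-- ε''_n(A) := 2 r(A) sin(π/(2n+2)) + ‖C‖. -/
noncomputable def epsTau1 {N : ℕ} {m : Fin N → ℕ}
    (a : ∀ i j : Fin N, Matrix (Fin (m i)) (Fin (m j)) ℂ) (n : ℕ) : ℝ :=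
  2 * rA a * Real.sin (Real.pi / (2 * (n : ℝ) + 2))
    + opNorm (blockMat m (remPart a))

/-- The τ₁-method inclusion set Γ^n_ε(A): the union over `k` of the closed
`(ε+ε''_n(A))`-pseudospectra of the rectangular matrices `B^+_{n,k}`. -/
lemma kwin {N n : ℕ} (h : n ≤ N) (k : Fin (N - n + 1)) : (k : ℕ) + n ≤ N := by
  have := k.isLt; omega

noncomputable def GammaTau1 {N : ℕ} {m : Fin N → ℕ}
    (a : ∀ i j : Fin N, Matrix (Fin (m i)) (Fin (m j)) ℂ)
    (n : ℕ) (h : n ≤ N) (ε : ℝ) : Set ℂ :=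
  ⋃ k : Fin (N - n + 1),
    {z : ℂ | sval (Bplus (triPart a) n k (kwin h k)
        - z • IplusMat m n k (kwin h k)) ≤ ε + epsTau1 a n}

end SpecIncl

namespace SpecIncl

theorem toEuclideanLin_coord {ι κ : Type*} [Fintype ι] [Fintype κ] [DecidableEq κ]
    (F : Matrix ι κ ℂ) (x : EuclideanSpace ℂ κ) (p : ι) :
    Matrix.toEuclideanLin F x p = ∑ q, F p q * x q := by
  simp [Matrix.toLpLin_apply, Matrix.mulVec, dotProduct]

theorem bddAbove_image_sphere {ι κ : Type*} [Fintype ι] [Fintype κ] [DecidableEq κ]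
    (F : Matrix ι κ ℂ) :
    BddAbove {y : ℝ | ∃ x : EuclideanSpace ℂ κ, ‖x‖ = 1 ∧ y = ‖Matrix.toEuclideanLin F x‖} := by
  refine ⟨‖(Matrix.toEuclideanLin F).toContinuousLinearMap‖, ?_⟩
  rintro y ⟨x, hx, rfl⟩
  simpa [hx] using (Matrix.toEuclideanLin F).toContinuousLinearMap.le_opNorm x

theorem norm_toEuclideanLin_le {ι κ : Type*} [Fintype ι] [Fintype κ] [DecidableEq κ]
    (F : Matrix ι κ ℂ) (x : EuclideanSpace ℂ κ) :
    ‖Matrix.toEuclideanLin F x‖ ≤ opNorm F * ‖x‖ := by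
  rcases eq_or_ne x 0 with rfl | hx
  · simp
  have hx' : 0 < ‖x‖ := norm_pos_iff.mpr hx
  have h := le_csSup (bddAbove_image_sphere F)
    ⟨((‖x‖⁻¹ : ℝ) : ℂ) • x, by simp [norm_smul, hx'.ne'], rfl⟩
  rw [map_smul, norm_smul, Complex.norm_real, norm_inv, norm_norm, inv_mul_le_iff₀ hx'] at h
  rwa [mul_comm]

theorem opNorm_nonneg {ι κ : Type*} [Fintype ι] [Fintype κ] [DecidableEq κ]
    (F : Matrix ι κ ℂ) : 0 ≤ opNorm F :=
  Real.sSup_nonneg (by rintro y ⟨x, -, rfl⟩; exact norm_nonneg _)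

theorem sval_le_of_norm_le {ι κ : Type*} [Fintype ι] [Fintype κ] [DecidableEq κ]
    {F : Matrix ι κ ℂ} {x : EuclideanSpace ℂ κ} {c : ℝ} (hx : x ≠ 0)
    (h : ‖Matrix.toEuclideanLin F x‖ ≤ c * ‖x‖) : sval F ≤ c := by
  have hx' : 0 < ‖x‖ := norm_pos_iff.mpr hx
  have hb : BddBelow
      {y : ℝ | ∃ x : EuclideanSpace ℂ κ, ‖x‖ = 1 ∧ y = ‖Matrix.toEuclideanLin F x‖} :=
    ⟨0, by rintro y ⟨x, -, rfl⟩; exact norm_nonneg _⟩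
  refine (csInf_le hb
    ⟨((‖x‖⁻¹ : ℝ) : ℂ) • x, by simp [norm_smul, hx'.ne'], rfl⟩).trans ?_
  rw [map_smul, norm_smul, Complex.norm_real, norm_inv, norm_norm, inv_mul_le_iff₀ hx']
  rwa [mul_comm]

theorem exists_norm_eq_sval {ι κ : Type*} [Fintype ι] [Fintype κ] [DecidableEq κ] [Nonempty κ]
    (F : Matrix ι κ ℂ) :
    ∃ x : EuclideanSpace ℂ κ, ‖x‖ = 1 ∧ ‖Matrix.toEuclideanLin F x‖ = sval F := by
  have hc : IsCompact ((fun x => ‖Matrix.toEuclideanLin F x‖) ''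
      Metric.sphere (0 : EuclideanSpace ℂ κ) 1) :=
    (isCompact_sphere _ _).image
      (continuous_norm.comp (Matrix.toEuclideanLin F).continuous_of_finiteDimensional)
  have hne : (Metric.sphere (0 : EuclideanSpace ℂ κ) 1).Nonempty :=
    NormedSpace.sphere_nonempty.mpr zero_le_one
  obtain ⟨x, hx, hxs⟩ := hc.sInf_mem (hne.image _)
  refine ⟨x, by simpa using hx, hxs.trans ?_⟩
  unfold sval
  congr 1
  ext y
  simp [eq_comm]

/-- Sums of `f` over `[c, c + T)` and `[0, K)` agree if `f` vanishes where the intervals differ. -/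
theorem sum_range_shift {f : ℤ → ℝ} {K T : ℕ} {c : ℤ}
    (hf : ∀ s : ℤ, s ∈ Set.Ico c (c + T) → s ∉ Set.Ico (0 : ℤ) K → f s = 0)
    (hf' : ∀ s : ℤ, s ∈ Set.Ico (0 : ℤ) K → s ∉ Set.Ico c (c + T) → f s = 0) :
    ∑ t ∈ Finset.range T, f (c + t) = ∑ j ∈ Finset.range K, f j := by
  have key : ∀ (d : ℤ) (M : ℕ), ∑ t ∈ Finset.range M, f (d + t)
      = ∑ s ∈ Finset.Ico d (d + M), f s := by
    intro d M
    refine Finset.sum_bij (fun t _ => d + t) ?_ ?_ ?_ ?_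
    · intro t ht
      simp only [Finset.mem_range, Finset.mem_Ico] at ht ⊢
      omega
    · intro t _ t' _ h
      omega
    · intro s hs
      simp only [Finset.mem_Ico] at hs
      exact ⟨(s - d).toNat, by simp only [Finset.mem_range]; omega, by omega⟩
    · intros
      rfl
  have h0 := key 0 K
  simp only [zero_add] at h0
  rw [key, h0, Finset.sum_subset
    (Finset.subset_union_right (s₁ := Finset.Ico c (c + T)) (s₂ := Finset.Ico (0 : ℤ) K))]
  · refine Finset.sum_subset Finset.subset_union_left ?_
    intro s hs hs'
    rw [Finset.mem_union] at hs
    simp only [Finset.mem_Ico] at hs hs'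
    exact hf' s (by simp only [Set.mem_Ico]; tauto) (by simpa using hs')
  · intro s hs hs'
    rw [Finset.mem_union] at hs
    simp only [Finset.mem_Ico] at hs hs'
    exact hf s (by simp only [Set.mem_Ico]; tauto) (by simpa using hs')

/-- The sine weights of a window of length `n`, extended by zero. -/
def wt (n : ℕ) (s : ℤ) : ℝ :=
  if 0 ≤ s ∧ s ≤ n + 1 then Real.sin (s * (Real.pi / (n + 1))) else 0

theorem wt_eq_zero {n : ℕ} {s : ℤ} (h : ¬ (1 ≤ s ∧ s ≤ n)) : wt n s = 0 := by
  unfold wt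
  split_ifs with hs
  · obtain rfl | rfl : s = 0 ∨ s = n + 1 := by omega
    · simp
    · have : ((n : ℝ) + 1) ≠ 0 := by positivity
      push_cast
      rw [mul_div_cancel₀ _ this, Real.sin_pi]
  · rfl

theorem sum_sq_sub_sin (θ : ℝ) (M : ℕ) :
    ∑ j ∈ Finset.range M, (Real.sin ((j + 1) * θ) - Real.sin (j * θ)) ^ 2
      = 4 * Real.sin (θ / 2) ^ 2 * ∑ j ∈ Finset.range M, Real.sin (j * θ) ^ 2
        + Real.sin (M * θ) * (Real.sin (M * θ) - Real.sin ((M - 1) * θ)) := by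
  induction M with
  | zero => simp
  | succ M ih =>
    rw [Finset.sum_range_succ, Finset.sum_range_succ, ih]
    have h2 : 4 * Real.sin (θ / 2) ^ 2 = 2 - 2 * Real.cos θ := by
      have h := Real.cos_two_mul' (θ / 2)
      rw [mul_div_cancel₀ _ two_ne_zero] at h
      have := Real.sin_sq_add_cos_sq (θ / 2)
      linarith
    have h3 : Real.sin ((M + 1) * θ) + Real.sin ((M - 1) * θ)
        = 2 * Real.cos θ * Real.sin (M * θ) := by
      rw [add_mul, sub_mul, one_mul, Real.sin_add, Real.sin_sub]
      ring
    rw [h2]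
    push_cast
    rw [show (M + 1 - 1 : ℝ) = M by ring]
    linear_combination (-Real.sin (M * θ)) * h3

/-- The total squared weight. -/
def wtMass (n : ℕ) : ℝ := ∑ j ∈ Finset.range (n + 1), wt n j ^ 2

theorem wtMass_pos {n : ℕ} (hn : 1 ≤ n) : 0 < wtMass n := by
  refine Finset.sum_pos' (fun _ _ => sq_nonneg _) ⟨1, by simp; omega, ?_⟩
  have h1 : (1 : ℝ) ≤ n := by exact_mod_cast hn
  have : 0 < wt n ((1 : ℕ) : ℤ) := by
    rw [wt, if_pos (by omega)]
    push_cast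
    rw [one_mul]
    refine Real.sin_pos_of_pos_of_lt_pi (by positivity) ?_
    exact div_lt_self Real.pi_pos (by linarith)
  positivity

theorem sum_wt_sq {n N T : ℕ} (hT : N + n + 1 ≤ T) {i : ℕ} (hi : i < N) :
    ∑ t ∈ Finset.range T, wt n (t - i) ^ 2 = wtMass n := by
  have := sum_range_shift (f := fun s => wt n s ^ 2) (K := n + 1) (T := T) (c := -i) ?_ ?_
  · simpa only [neg_add_eq_sub, wtMass] using this
  · intro s _ hs
    simp only [Set.mem_Ico] at hs
    simp [wt_eq_zero (n := n) (s := s) (by push_cast at hs; omega)]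
  · intro s hs hs'
    simp only [Set.mem_Ico] at hs hs'
    exfalso
    push_cast at hs
    omega

theorem sum_wt_sub_sq_base (n : ℕ) :
    ∑ j ∈ Finset.range (n + 1), (wt n (j + 1) - wt n j) ^ 2
      = 4 * Real.sin (Real.pi / (2 * n + 2)) ^ 2 * wtMass n := by
  have hne : ((n : ℝ) + 1) ≠ 0 := by positivity
  have h := sum_sq_sub_sin (Real.pi / (n + 1)) (n + 1)
  push_cast at h
  rw [mul_div_cancel₀ _ hne, Real.sin_pi, zero_mul, add_zero, div_div,
    show ((n : ℝ) + 1) * 2 = 2 * n + 2 by ring] at h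
  rw [wtMass]
  refine Eq.trans (Finset.sum_congr rfl fun j hj => ?_)
    (h.trans (congrArg _ (Finset.sum_congr rfl fun j hj => ?_)))
  · have := Finset.mem_range.mp hj
    rw [wt, wt, if_pos (by omega), if_pos (by omega)]
    push_cast
    rfl
  · have := Finset.mem_range.mp hj
    rw [wt, if_pos (by omega)]
    push_cast
    rfl

theorem sum_wt_sub_sq {n N T : ℕ} (hT : N + n + 1 ≤ T) {i : ℤ} (hi0 : 0 ≤ i) (hi : i ≤ N) :
    ∑ t ∈ Finset.range T, (wt n (t - i + 1) - wt n (t - i)) ^ 2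
      = 4 * Real.sin (Real.pi / (2 * n + 2)) ^ 2 * wtMass n := by
  rw [← sum_wt_sub_sq_base]
  have := sum_range_shift (f := fun s => (wt n (s + 1) - wt n s) ^ 2) (K := n + 1) (T := T)
    (c := -i) ?_ ?_
  · simpa only [neg_add_eq_sub] using this
  · intro s _ hs
    simp only [Set.mem_Ico] at hs
    push_cast at hs
    simp [wt_eq_zero (n := n) (s := s) (by omega), wt_eq_zero (n := n) (s := s + 1) (by omega)]
  · intro s hs hs'
    simp only [Set.mem_Ico] at hs hs'
    exfalso
    push_cast at hs
    omega

/-- The inclusion of the block indices of a window into all block indices. -/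
def winEmb {N n k : ℕ} {m : Fin N → ℕ} (h : k + n ≤ N)
    (q : (j : Fin n) × Fin (m (widx h j))) : (i : Fin N) × Fin (m i) :=
  ⟨widx h q.1, q.2⟩

theorem winEmb_injective {N n k : ℕ} {m : Fin N → ℕ} (h : k + n ≤ N) :
    Function.Injective (winEmb (m := m) h) := by
  rintro ⟨j, β⟩ ⟨j', β'⟩ hq
  have h1 : widx h j = widx h j' := congrArg Sigma.fst hq
  obtain rfl : j = j' := by
    have := congrArg Fin.val h1
    simp only [widx] at this
    exact Fin.ext (by omega)
  simp only [winEmb, Sigma.mk.injEq, heq_eq_eq, true_and] at hq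
  rw [hq]

theorem mem_range_winEmb {N n k : ℕ} {m : Fin N → ℕ} (h : k + n ≤ N)
    {p : (i : Fin N) × Fin (m i)} (hp : k ≤ p.1 ∧ (p.1 : ℕ) < k + n) :
    p ∈ Set.range (winEmb (m := m) h) := by
  obtain ⟨⟨i, hi⟩, α⟩ := p
  obtain ⟨j, rfl⟩ := Nat.exists_eq_add_of_le hp.1
  exact ⟨⟨⟨j, by simpa using hp.2⟩, α⟩, rfl⟩

theorem rsz_natCast {N : ℕ} (m : Fin N → ℕ) (i : Fin N) : rsz m ((i : ℕ) : ℤ) = m i := by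
  rw [rsz, dif_pos (by have := i.isLt; omega)]
  simp

theorem sb_natCast {N : ℕ} {m : Fin N → ℕ}
    (b : ∀ i j : Fin N, Matrix (Fin (m i)) (Fin (m j)) ℂ) (i j : Fin N)
    (α : Fin (m i)) (β : Fin (m j)) : sb b ((i : ℕ) : ℤ) ((j : ℕ) : ℤ) α β = b i j α β := by
  simp [sb]

/-- The rows of `(B - z) v`, with `B` extended by zeros. -/
def extRow {N : ℕ} {m : Fin N → ℕ} (b : ∀ i j : Fin N, Matrix (Fin (m i)) (Fin (m j)) ℂ)
    (z : ℂ) (v : EuclideanSpace ℂ ((i : Fin N) × Fin (m i))) (i : ℤ) (α : ℕ) : ℂ :=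
  ∑ p, (sb b i ((p.1 : ℕ) : ℤ) α p.2
    - z * if i = ((p.1 : ℕ) : ℤ) ∧ α = (p.2 : ℕ) then 1 else 0) * v p

theorem toEuclideanLin_blockMat_sub_smul_one {N : ℕ} {m : Fin N → ℕ}
    (b : ∀ i j : Fin N, Matrix (Fin (m i)) (Fin (m j)) ℂ) (z : ℂ)
    (v : EuclideanSpace ℂ ((i : Fin N) × Fin (m i))) (p : (i : Fin N) × Fin (m i)) :
    Matrix.toEuclideanLin (blockMat m b - z • 1) v p
      = extRow b z v ((p.1 : ℕ) : ℤ) p.2 := by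
  rw [toEuclideanLin_coord, extRow]
  refine Finset.sum_congr rfl fun q _ => ?_
  rw [sb_natCast, Matrix.sub_apply, Matrix.smul_apply, Matrix.one_apply, smul_eq_mul]
  refine congrArg (fun c : ℂ => (b p.1 q.1 p.2 q.2 - z * c) * v q) (if_congr ?_ rfl rfl)
  obtain ⟨i, α⟩ := p
  obtain ⟨j, β⟩ := q
  constructor
  · rintro h
    cases h
    simp
  · rintro ⟨h1, h2⟩
    obtain rfl : i = j := Fin.ext (by exact_mod_cast h1)
    exact congrArg _ (Fin.ext h2 : α = β)

theorem toEuclideanLin_Bplus_sub_smul_Iplus {N n k : ℕ} {m : Fin N → ℕ}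
    (b : ∀ i j : Fin N, Matrix (Fin (m i)) (Fin (m j)) ℂ) (z : ℂ) (h : k + n ≤ N)
    (v : EuclideanSpace ℂ ((i : Fin N) × Fin (m i)))
    (hv : ∀ p, p ∉ Set.range (winEmb (m := m) h) → v p = 0)
    (p : (i : Fin (n + 2)) × Fin (rsz m ((k : ℤ) - 1 + i))) :
    Matrix.toEuclideanLin (Bplus b n k h - z • IplusMat m n k h)
        (WithLp.toLp 2 fun q => v (winEmb h q)) p
      = extRow b z v ((k : ℤ) - 1 + p.1) p.2 := by
  rw [toEuclideanLin_coord, extRow]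
  refine Fintype.sum_of_injective (winEmb h) (winEmb_injective h) _ _ ?_ ?_
  · intro q hq
    rw [hv q hq, mul_zero]
  · intro q
    rw [Matrix.sub_apply, Matrix.smul_apply, smul_eq_mul]
    have hc : (((winEmb h q).1 : ℕ) : ℤ) = (k : ℤ) + ((q.1 : ℕ) : ℤ) := Nat.cast_add _ _
    rw [hc]
    refine congrArg (fun c : ℂ => (Bplus b n k h p q - z * c) * v (winEmb h q))
      (if_congr (and_congr ?_ Iff.rfl) rfl rfl)
    omega

theorem extRow_eq_zero_of_notMem_range {N : ℕ} {m : Fin N → ℕ}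
    (b : ∀ i j : Fin N, Matrix (Fin (m i)) (Fin (m j)) ℂ) (z : ℂ)
    (v : EuclideanSpace ℂ ((i : Fin N) × Fin (m i))) {i : ℤ} (hi : ¬ (0 ≤ i ∧ i < N)) (α : ℕ) :
    extRow b z v i α = 0 := by
  refine Finset.sum_eq_zero fun p _ => ?_
  have := p.1.isLt
  rw [sb, dif_neg hi, if_neg (by omega)]
  simp

theorem extRow_eq_zero_of_far {N n k : ℕ} {m : Fin N → ℕ} (h : k + n ≤ N)
    (b : ∀ i j : Fin N, Matrix (Fin (m i)) (Fin (m j)) ℂ)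
    (hb : ∀ i j : Fin N, 1 < |(i : ℤ) - (j : ℤ)| → b i j = 0) (z : ℂ)
    (v : EuclideanSpace ℂ ((i : Fin N) × Fin (m i)))
    (hv : ∀ p, p ∉ Set.range (winEmb (m := m) h) → v p = 0)
    {i : ℤ} (hi : ¬ ((k : ℤ) - 1 ≤ i ∧ i < (k : ℤ) - 1 + (n + 2 : ℕ))) (α : ℕ) :
    extRow b z v i α = 0 := by
  refine Finset.sum_eq_zero fun p _ => ?_
  by_cases hp : p ∈ Set.range (winEmb (m := m) h)
  · obtain ⟨q, rfl⟩ := hp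
    have hq := q.1.isLt
    have hc : (((winEmb h q).1 : ℕ) : ℤ) = (k : ℤ) + ((q.1 : ℕ) : ℤ) := Nat.cast_add _ _
    rw [hc]
    push_cast at hi
    have hsb : sb b i ((k : ℤ) + ((q.1 : ℕ) : ℤ)) α ((winEmb h q).2 : ℕ) = 0 := by
      unfold sb
      split_ifs <;> try rfl
      rw [hb]
      · rfl
      · rw [lt_abs]
        push_cast
        omega
    rw [hsb, if_neg (by omega)]
    simp
  · rw [hv p hp, mul_zero]

theorem norm_Bplus_eq {N n k : ℕ} {m : Fin N → ℕ} (h : k + n ≤ N)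
    (b : ∀ i j : Fin N, Matrix (Fin (m i)) (Fin (m j)) ℂ)
    (hb : ∀ i j : Fin N, 1 < |(i : ℤ) - (j : ℤ)| → b i j = 0) (z : ℂ)
    (v : EuclideanSpace ℂ ((i : Fin N) × Fin (m i)))
    (hv : ∀ p, p ∉ Set.range (winEmb (m := m) h) → v p = 0) :
    ‖Matrix.toEuclideanLin (Bplus b n k h - z • IplusMat m n k h)
        (WithLp.toLp 2 fun q => v (winEmb h q))‖
      = ‖Matrix.toEuclideanLin (blockMat m b - z • 1) v‖ := by
  rw [← sq_eq_sq₀ (norm_nonneg _) (norm_nonneg _), EuclideanSpace.norm_sq_eq,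
    EuclideanSpace.norm_sq_eq]
  simp only [toEuclideanLin_blockMat_sub_smul_one, toEuclideanLin_Bplus_sub_smul_Iplus b z h v hv]
  rw [Fintype.sum_sigma, Fintype.sum_sigma]
  set g : ℤ → ℝ := fun i => ∑ α ∈ Finset.range (rsz m i), ‖extRow b z v i α‖ ^ 2 with hg
  have h1 : ∀ i : Fin (n + 2), ∑ α : Fin (rsz m ((k : ℤ) - 1 + i)),
      ‖extRow b z v ((k : ℤ) - 1 + i) α‖ ^ 2 = g ((k : ℤ) - 1 + i) := fun i =>
    Fin.sum_univ_eq_sum_range (fun α => ‖extRow b z v ((k : ℤ) - 1 + i) α‖ ^ 2) _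
  have h2 : ∀ i : Fin N, ∑ α : Fin (m i), ‖extRow b z v ((i : ℕ) : ℤ) α‖ ^ 2
      = g ((i : ℕ) : ℤ) := fun i => by
    rw [hg]
    simp only [rsz_natCast]
    exact Fin.sum_univ_eq_sum_range (fun α => ‖extRow b z v ((i : ℕ) : ℤ) α‖ ^ 2) _
  simp only [h1, h2]
  rw [Fin.sum_univ_eq_sum_range (fun i => g ((k : ℤ) - 1 + i)),
    Fin.sum_univ_eq_sum_range (fun i => g i)]
  refine sum_range_shift ?_ ?_
  · intro s _ hs
    exact Finset.sum_eq_zero fun α _ => by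
      rw [extRow_eq_zero_of_notMem_range b z v (by simpa using hs)]; simp
  · intro s _ hs
    exact Finset.sum_eq_zero fun α _ => by
      rw [extRow_eq_zero_of_far h b hb z v hv (by simpa using hs)]; simp

theorem norm_restrict_eq {N n k : ℕ} {m : Fin N → ℕ} (h : k + n ≤ N)
    (v : EuclideanSpace ℂ ((i : Fin N) × Fin (m i)))
    (hv : ∀ p, p ∉ Set.range (winEmb (m := m) h) → v p = 0) :
    ‖(WithLp.toLp 2 fun q => v (winEmb h q) :
      EuclideanSpace ℂ ((j : Fin n) × Fin (m (widx h j))))‖ = ‖v‖ := by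
  rw [← sq_eq_sq₀ (norm_nonneg _) (norm_nonneg _), EuclideanSpace.norm_sq_eq,
    EuclideanSpace.norm_sq_eq]
  refine Fintype.sum_of_injective (winEmb h) (winEmb_injective h) _ _ ?_ fun _ => rfl
  intro q hq
  simp [hv q hq]

/-- Multiplication by a real diagonal matrix. -/
def diagMul {ι : Type*} [Fintype ι] (c : ι → ℝ) (x : EuclideanSpace ℂ ι) : EuclideanSpace ℂ ι :=
  WithLp.toLp 2 fun p => (c p : ℂ) * x p

theorem sum_norm_sq_diagMul {ι : Type*} [Fintype ι] {T : ℕ} (c : ℕ → ι → ℝ) {K : ℝ}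
    (hc : ∀ p, ∑ t ∈ Finset.range T, c t p ^ 2 = K) (x : EuclideanSpace ℂ ι) :
    ∑ t ∈ Finset.range T, ‖diagMul (c t) x‖ ^ 2 = K * ‖x‖ ^ 2 := by
  simp only [EuclideanSpace.norm_sq_eq, diagMul, norm_mul, mul_pow, Complex.norm_real,
    Real.norm_eq_abs, sq_abs]
  rw [Finset.sum_comm, Finset.mul_sum]
  refine Finset.sum_congr rfl fun p _ => ?_
  rw [← Finset.sum_mul, hc]

/-- Minkowski's inequality for three families of vectors. -/
theorem sum_norm_sq_add_add_le {E : Type*} [NormedAddCommGroup E] {T : ℕ}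
    (u v w : ℕ → E) {α β γ : ℝ} (hα : 0 ≤ α) (hβ : 0 ≤ β) (hγ : 0 ≤ γ)
    (hu : ∑ t ∈ Finset.range T, ‖u t‖ ^ 2 ≤ α ^ 2)
    (hv : ∑ t ∈ Finset.range T, ‖v t‖ ^ 2 ≤ β ^ 2)
    (hw : ∑ t ∈ Finset.range T, ‖w t‖ ^ 2 ≤ γ ^ 2) :
    ∑ t ∈ Finset.range T, ‖u t + v t + w t‖ ^ 2 ≤ (α + β + γ) ^ 2 := by
  let L : (ℕ → E) → PiLp 2 (fun _ : Fin T => E) := fun f => WithLp.toLp 2 fun t => f t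
  have hL : ∀ f : ℕ → E, ‖L f‖ ^ 2 = ∑ t ∈ Finset.range T, ‖f t‖ ^ 2 := fun f => by
    rw [PiLp.norm_sq_eq_of_L2]
    exact Fin.sum_univ_eq_sum_range (fun t => ‖f t‖ ^ 2) T
  have hadd : L (fun t => u t + v t + w t) = L u + L v + L w := rfl
  rw [← hL] at hu hv hw ⊢
  rw [hadd]
  have hu' := abs_le_of_sq_le_sq' hu hα
  have hv' := abs_le_of_sq_le_sq' hv hβ
  have hw' := abs_le_of_sq_le_sq' hw hγ
  have := norm_add₃_le (a := L u) (b := L v) (c := L w)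
  exact pow_le_pow_left₀ (norm_nonneg _) (by linarith [hu'.2, hv'.2, hw'.2]) 2

/-- The part of a block matrix supported on the block positions satisfying `R`. -/
def relPart {N : ℕ} {m : Fin N → ℕ} (R : Fin N → Fin N → Prop) [∀ i j, Decidable (R i j)]
    (a : ∀ i j : Fin N, Matrix (Fin (m i)) (Fin (m j)) ℂ) :
    ∀ i j : Fin N, Matrix (Fin (m i)) (Fin (m j)) ℂ :=
  fun i j => if R i j then a i j else 0

/-- A block matrix with at most one nonzero block in each block row and block column is bounded
by the largest norm of its blocks. -/
theorem norm_relPart_le {N : ℕ} {m : Fin N → ℕ} (R : Fin N → Fin N → Prop)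
    [∀ i j, Decidable (R i j)] (hrow : ∀ i j j', R i j → R i j' → j = j')
    (hcol : ∀ i i' j, R i j → R i' j → i = i')
    (a : ∀ i j : Fin N, Matrix (Fin (m i)) (Fin (m j)) ℂ) {r : ℝ} (hr : 0 ≤ r)
    (ha : ∀ i j, R i j → opNorm (a i j) ≤ r)
    (x : EuclideanSpace ℂ ((i : Fin N) × Fin (m i))) :
    ‖Matrix.toEuclideanLin (blockMat m (relPart R a)) x‖ ≤ r * ‖x‖ := by
  refine (sq_le_sq₀ (norm_nonneg _) (by positivity)).mp ?_
  let y : ∀ j : Fin N, EuclideanSpace ℂ (Fin (m j)) := fun j => WithLp.toLp 2 fun β => x ⟨j, β⟩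
  have hx : ‖x‖ ^ 2 = ∑ j, ‖y j‖ ^ 2 := by
    simp only [EuclideanSpace.norm_sq_eq, y]
    rw [Fintype.sum_sigma]
  have hrowle : ∀ i, ∑ α, ‖Matrix.toEuclideanLin (blockMat m (relPart R a)) x ⟨i, α⟩‖ ^ 2
      ≤ ∑ j, if R i j then r ^ 2 * ‖y j‖ ^ 2 else 0 := by
    intro i
    by_cases h : ∃ j, R i j
    · obtain ⟨j, hj⟩ := h
      have hR : ∀ j', R i j' ↔ j' = j := fun j' =>
        ⟨fun h' => hrow i j' j h' hj, fun h' => h' ▸ hj⟩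
      simp only [hR, Finset.sum_ite_eq', Finset.mem_univ, if_true]
      have heq : ∀ α, Matrix.toEuclideanLin (blockMat m (relPart R a)) x ⟨i, α⟩
          = Matrix.toEuclideanLin (a i j) (y j) α := by
        intro α
        rw [toEuclideanLin_coord, toEuclideanLin_coord, Fintype.sum_sigma,
          Finset.sum_eq_single j]
        · simp [blockMat, relPart, hj, y]
        · intro j' _ hj'
          simp [blockMat, relPart, hR, hj']
        · simp
      simp only [heq]
      rw [← EuclideanSpace.norm_sq_eq, ← mul_pow]
      refine pow_le_pow_left₀ (norm_nonneg _) ((norm_toEuclideanLin_le _ _).trans ?_) 2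
      exact mul_le_mul_of_nonneg_right (ha i j hj) (norm_nonneg _)
    · push Not at h
      refine (Finset.sum_eq_zero fun α _ => ?_).le.trans
        (Finset.sum_nonneg fun j _ => by rw [if_neg (h j)])
      rw [toEuclideanLin_coord, Finset.sum_eq_zero]
      · simp
      · intro q _
        simp [blockMat, relPart, h]
  rw [EuclideanSpace.norm_sq_eq, Fintype.sum_sigma, mul_pow, hx, Finset.mul_sum]
  refine (Finset.sum_le_sum fun i _ => hrowle i).trans ?_
  rw [Finset.sum_comm]
  refine Finset.sum_le_sum fun j _ => ?_
  by_cases h : ∃ i, R i j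
  · obtain ⟨i, hi⟩ := h
    have hR : ∀ i', R i' j ↔ i' = i := fun i' =>
      ⟨fun h' => hcol i' i j h' hi, fun h' => h' ▸ hi⟩
    simp [hR]
  · push Not at h
    simp only [h, if_false, Finset.sum_const_zero]
    positivity

theorem opNorm_le_rL {N : ℕ} {m : Fin N → ℕ}
    (a : ∀ i j : Fin N, Matrix (Fin (m i)) (Fin (m j)) ℂ) {i j : Fin N}
    (h : (j : ℕ) + 1 = i) : opNorm (a i j) ≤ rL a := by
  refine le_csSup (Set.Finite.bddAbove ?_) ⟨i, j, h, rfl⟩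
  refine (Set.finite_range fun p : Fin N × Fin N => opNorm (a p.1 p.2)).subset ?_
  rintro y ⟨i, j, -, rfl⟩
  exact ⟨(i, j), rfl⟩

theorem opNorm_le_rU {N : ℕ} {m : Fin N → ℕ}
    (a : ∀ i j : Fin N, Matrix (Fin (m i)) (Fin (m j)) ℂ) {i j : Fin N}
    (h : (i : ℕ) + 1 = j) : opNorm (a i j) ≤ rU a := by
  refine le_csSup (Set.Finite.bddAbove ?_) ⟨i, j, h, rfl⟩
  refine (Set.finite_range fun p : Fin N × Fin N => opNorm (a p.1 p.2)).subset ?_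
  rintro y ⟨i, j, -, rfl⟩
  exact ⟨(i, j), rfl⟩

theorem rL_nonneg {N : ℕ} {m : Fin N → ℕ}
    (a : ∀ i j : Fin N, Matrix (Fin (m i)) (Fin (m j)) ℂ) : 0 ≤ rL a :=
  Real.sSup_nonneg (by rintro y ⟨i, j, -, rfl⟩; exact opNorm_nonneg _)

theorem rU_nonneg {N : ℕ} {m : Fin N → ℕ}
    (a : ∀ i j : Fin N, Matrix (Fin (m i)) (Fin (m j)) ℂ) : 0 ≤ rU a :=
  Real.sSup_nonneg (by rintro y ⟨i, j, -, rfl⟩; exact opNorm_nonneg _)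

/-- The commutator identity for the tridiagonal part and a diagonal matrix which is constant on
blocks. -/
theorem triPart_diagMul {N : ℕ} {m : Fin N → ℕ}
    (a : ∀ i j : Fin N, Matrix (Fin (m i)) (Fin (m j)) ℂ) (z : ℂ) (w : ℤ → ℝ)
    (x : EuclideanSpace ℂ ((i : Fin N) × Fin (m i))) :
    Matrix.toEuclideanLin (blockMat m (triPart a) - z • 1)
        (diagMul (fun p => w ((p.1 : ℕ) : ℤ)) x)
      = diagMul (fun p => w ((p.1 : ℕ) : ℤ))
          (Matrix.toEuclideanLin (blockMat m (triPart a) - z • 1) x)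
        + diagMul (fun p => w (((p.1 : ℕ) : ℤ) - 1) - w ((p.1 : ℕ) : ℤ))
          (Matrix.toEuclideanLin
            (blockMat m (relPart (fun i j => (j : ℕ) + 1 = (i : ℕ)) a)) x)
        + diagMul (fun p => w (((p.1 : ℕ) : ℤ) + 1) - w ((p.1 : ℕ) : ℤ))
          (Matrix.toEuclideanLin
            (blockMat m (relPart (fun i j => (i : ℕ) + 1 = (j : ℕ)) a)) x) := by
  ext p
  simp only [diagMul, PiLp.add_apply, toEuclideanLin_coord, Finset.mul_sum,
    ← Finset.sum_add_distrib]
  refine Finset.sum_congr rfl fun q _ => ?_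
  simp only [Matrix.sub_apply, Matrix.smul_apply, smul_eq_mul, blockMat, relPart, triPart]
  obtain ⟨i, α⟩ := p
  obtain ⟨j, β⟩ := q
  dsimp only
  by_cases hij : i = j
  · subst hij
    simp
    ring
  · have hne : (i : ℕ) ≠ j := fun h => hij (Fin.ext h)
    have h1 : (1 : Matrix ((i : Fin N) × Fin (m i)) ((i : Fin N) × Fin (m i)) ℂ)
        ⟨i, α⟩ ⟨j, β⟩ = 0 := Matrix.one_apply_ne fun h => hij (congrArg Sigma.fst h)
    rw [h1]
    by_cases hL : (j : ℕ) + 1 = i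
    · rw [if_pos (by rw [abs_le]; omega), if_pos hL, if_neg (by omega),
        show ((i : ℕ) : ℤ) - 1 = ((j : ℕ) : ℤ) by omega]
      push_cast
      simp
      ring
    · by_cases hU : (i : ℕ) + 1 = j
      · rw [if_pos (by rw [abs_le]; omega), if_neg hL, if_pos hU,
          show ((i : ℕ) : ℤ) + 1 = ((j : ℕ) : ℤ) by omega]
        push_cast
        simp
        ring
      · rw [if_neg (by rw [abs_le]; omega), if_neg hL, if_neg hU]
        simp

/-- Localization: an approximate eigenvector of the tridiagonal part can be cut off to a window of
length `n` at the cost of `2 r sin(π / (2n + 2))`. -/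
theorem exists_localized {N : ℕ} {m : Fin N → ℕ}
    (a : ∀ i j : Fin N, Matrix (Fin (m i)) (Fin (m j)) ℂ) (z : ℂ) {n : ℕ} (hn : 1 ≤ n)
    {δ : ℝ} (hδ : 0 ≤ δ) (x : EuclideanSpace ℂ ((i : Fin N) × Fin (m i))) (hx : ‖x‖ = 1)
    (hxδ : ‖Matrix.toEuclideanLin (blockMat m (triPart a) - z • 1) x‖ ≤ δ) :
    ∃ t : ℕ, ∃ v : EuclideanSpace ℂ ((i : Fin N) × Fin (m i)), v ≠ 0 ∧
      (∀ p, ¬ (1 ≤ (t : ℤ) - (p.1 : ℕ) ∧ (t : ℤ) - (p.1 : ℕ) ≤ n) → v p = 0) ∧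
      ‖Matrix.toEuclideanLin (blockMat m (triPart a) - z • 1) v‖
        ≤ (δ + 2 * rA a * Real.sin (Real.pi / (2 * n + 2))) * ‖v‖ := by
  set T := N + n + 1
  set F := Matrix.toEuclideanLin (blockMat m (triPart a) - z • 1)
  set σ := Real.sin (Real.pi / (2 * n + 2))
  have hσ0 : 0 ≤ σ := by
    refine Real.sin_nonneg_of_nonneg_of_le_pi (by positivity) (div_le_self Real.pi_pos.le ?_)
    have : (0 : ℝ) ≤ n := n.cast_nonneg
    linarith
  set s := Real.sqrt (wtMass n)
  have hs2 : s ^ 2 = wtMass n := Real.sq_sqrt (wtMass_pos hn).le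
  have hs0 : 0 ≤ s := Real.sqrt_nonneg _
  have hrL := rL_nonneg a
  have hrU := rU_nonneg a
  let V : ℕ → EuclideanSpace ℂ ((i : Fin N) × Fin (m i)) := fun t =>
    diagMul (fun p => wt n (t - (p.1 : ℕ))) x
  have hV : ∑ t ∈ Finset.range T, ‖V t‖ ^ 2 = wtMass n := by
    rw [sum_norm_sq_diagMul _ (fun p => sum_wt_sq (N := N) le_rfl p.1.isLt) x, hx]
    simp
  have hL := norm_relPart_le (fun i j => (j : ℕ) + 1 = (i : ℕ))
    (fun i j j' h h' => Fin.ext (by omega)) (fun i i' j h h' => Fin.ext (by omega)) a hrL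
    (fun i j h => opNorm_le_rL a h) x
  have hU := norm_relPart_le (fun i j => (i : ℕ) + 1 = (j : ℕ))
    (fun i j j' h h' => Fin.ext (by omega)) (fun i i' j h h' => Fin.ext (by omega)) a hrU
    (fun i j h => opNorm_le_rU a h) x
  rw [hx, mul_one] at hL hU
  set c := δ + 2 * rA a * σ with hc
  have hFV : ∑ t ∈ Finset.range T, ‖F (V t)‖ ^ 2 ≤ c ^ 2 * wtMass n := by
    have hid : ∀ t : ℕ, F (V t) = _ := fun t =>
      triPart_diagMul a z (fun i => wt n (t - i)) x
    simp only [hid]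
    refine (sum_norm_sq_add_add_le _ _ _ (α := s * δ) (β := 2 * σ * s * rL a)
      (γ := 2 * σ * s * rU a) (by positivity) (by positivity) (by positivity)
      ?_ ?_ ?_).trans_eq ?_
    · rw [sum_norm_sq_diagMul _ (fun p => sum_wt_sq (N := N) le_rfl p.1.isLt), ← hs2, ← mul_pow]
      exact pow_le_pow_left₀ (by positivity) (by gcongr) 2
    · rw [sum_norm_sq_diagMul (K := 4 * σ ^ 2 * wtMass n) _ (fun p => ?_), ← hs2,
        show 4 * σ ^ 2 * s ^ 2 = (2 * σ * s) ^ 2 by ring, ← mul_pow]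
      · exact pow_le_pow_left₀ (by positivity) (by gcongr) 2
      · rw [← sum_wt_sub_sq (N := N) (T := T) (i := ((p.1 : ℕ) : ℤ)) le_rfl (by omega)
          (by have := p.1.isLt; omega)]
        refine Finset.sum_congr rfl fun t _ => ?_
        rw [show (t : ℤ) - (((p.1 : ℕ) : ℤ) - 1) = t - ((p.1 : ℕ) : ℤ) + 1 by ring]
    · rw [sum_norm_sq_diagMul (K := 4 * σ ^ 2 * wtMass n) _ (fun p => ?_), ← hs2,
        show 4 * σ ^ 2 * s ^ 2 = (2 * σ * s) ^ 2 by ring, ← mul_pow]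
      · exact pow_le_pow_left₀ (by positivity) (by gcongr) 2
      · rw [← sum_wt_sub_sq (N := N) (T := T) (i := ((p.1 : ℕ) : ℤ) + 1) le_rfl (by omega)
          (by have := p.1.isLt; omega)]
        refine Finset.sum_congr rfl fun t _ => ?_
        rw [show (t : ℤ) - (((p.1 : ℕ) : ℤ) + 1) + 1 = t - ((p.1 : ℕ) : ℤ) by ring]
        ring
    · rw [← hs2, hc, rA]
      ring
  have hc0 : 0 ≤ c := by
    rw [hc, rA]
    positivity
  by_contra hcon
  push Not at hcon
  have hstrict : ∀ t, V t ≠ 0 → c * ‖V t‖ < ‖F (V t)‖ := fun t ht =>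
    hcon t (V t) ht fun p hp => by
      simp [V, diagMul, wt_eq_zero (n := n) (s := (t : ℤ) - (p.1 : ℕ)) (by omega)]
  obtain ⟨t, htT, ht⟩ : ∃ t ∈ Finset.range T, V t ≠ 0 := by
    by_contra h0
    push Not at h0
    rw [Finset.sum_eq_zero fun t ht => by rw [h0 t ht]; simp] at hV
    exact (wtMass_pos hn).ne hV
  refine hFV.not_gt ?_
  rw [← hV, Finset.mul_sum]
  simp only [← mul_pow]
  refine Finset.sum_lt_sum (fun t _ => ?_) ⟨t, htT, ?_⟩
  · refine pow_le_pow_left₀ (by positivity) ?_ 2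
    rcases eq_or_ne (V t) 0 with h | h
    · simp [h]
    · exact (hstrict t h).le
  · exact pow_lt_pow_left₀ (hstrict t ht) (by positivity) two_ne_zero

theorem blockMat_eq_triPart_add_remPart {N : ℕ} {m : Fin N → ℕ}
    (a : ∀ i j : Fin N, Matrix (Fin (m i)) (Fin (m j)) ℂ) (z : ℂ) :
    blockMat m a - z • 1
      = (blockMat m (triPart a) - z • 1) + blockMat m (remPart a) := by
  ext p q
  simp only [Matrix.add_apply, Matrix.sub_apply, blockMat, triPart, remPart]
  split_ifs <;> simp
  ring

theorem triPart_eq_zero {N : ℕ} {m : Fin N → ℕ}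
    (a : ∀ i j : Fin N, Matrix (Fin (m i)) (Fin (m j)) ℂ) (i j : Fin N)
    (h : 1 < |(i : ℤ) - (j : ℤ)|) : triPart a i j = 0 :=
  if_neg h.not_ge

end SpecIncl

open SpecIncl in
/-- **Theorem 1.3 (the τ₁-method inclusion sets).** For every ε ≥ 0 and
n ∈ {1,…,N−1}: `Spec_ε A ⊆ Γ^n_ε(A) ⊆ Spec_{ε+ε''_n(A)+2‖C‖} A`; in particular
(taking ε = 0) `Spec A ⊆ Γ^n_0(A) ⊆ Spec_{ε''_n(A)+2‖C‖} A`. -/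
theorem tau1_method_inclusion {N : ℕ} (hN : 1 < N) {m : Fin N → ℕ}
    (hm : ∀ i, 0 < m i)
    (a : ∀ i j : Fin N, Matrix (Fin (m i)) (Fin (m j)) ℂ)
    (ε : ℝ) (hε : 0 ≤ ε) (n : ℕ) (hn : 1 ≤ n) (hnN : n ≤ N - 1) :
    pspec ε (blockMat m a) ⊆ GammaTau1 a n (by omega) ε ∧
    GammaTau1 a n (by omega) ε ⊆
      pspec (ε + epsTau1 a n + 2 * opNorm (blockMat m (remPart a))) (blockMat m a) := by
  have hC := opNorm_nonneg (blockMat m (remPart a))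
  constructor
  · intro z hz
    have : Nonempty ((i : Fin N) × Fin (m i)) := ⟨⟨⟨0, by omega⟩, ⟨0, hm _⟩⟩⟩
    obtain ⟨x, hx, hxs⟩ := exists_norm_eq_sval (blockMat m a - z • 1)
    have hxε : ‖Matrix.toEuclideanLin (blockMat m a - z • 1) x‖ ≤ ε := hxs.trans_le hz
    have hxδ : ‖Matrix.toEuclideanLin (blockMat m (triPart a) - z • 1) x‖
        ≤ ε + opNorm (blockMat m (remPart a)) := by
      rw [blockMat_eq_triPart_add_remPart, map_add, LinearMap.add_apply] at hxε
      have h1 := norm_toEuclideanLin_le (blockMat m (remPart a)) x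
      rw [hx, mul_one] at h1
      have h2 := norm_sub_le
        (Matrix.toEuclideanLin (blockMat m (triPart a) - z • 1) x
          + Matrix.toEuclideanLin (blockMat m (remPart a)) x)
        (Matrix.toEuclideanLin (blockMat m (remPart a)) x)
      rw [add_sub_cancel_right] at h2
      linarith
    obtain ⟨t, v, hv0, hv, hle⟩ := exists_localized a z hn (by positivity) x hx hxδ
    -- the window `[t - n, t - 1]`, moved inside `[0, N - 1]`
    obtain ⟨k, hk⟩ : ∃ k : Fin (N - n + 1), (k : ℕ) = min (t - n) (N - n) :=
      ⟨⟨min (t - n) (N - n), by omega⟩, rfl⟩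
    have hkn : (k : ℕ) + n ≤ N := kwin (by omega) k
    have hv' : ∀ p, p ∉ Set.range (winEmb (m := m) hkn) → v p = 0 := by
      intro p hp
      refine hv p fun hpt => hp (mem_range_winEmb hkn ?_)
      have := p.1.isLt
      omega
    refine Set.mem_iUnion.mpr ⟨k, ?_⟩
    refine sval_le_of_norm_le (x := WithLp.toLp 2 fun q => v (winEmb hkn q)) ?_ ?_
    · rwa [← norm_ne_zero_iff, norm_restrict_eq hkn v hv', norm_ne_zero_iff]
    · rw [norm_Bplus_eq hkn _ (triPart_eq_zero a) z v hv', norm_restrict_eq hkn v hv']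
      refine hle.trans_eq ?_
      rw [epsTau1]
      ring
  · intro z hz
    obtain ⟨k, hk⟩ := Set.mem_iUnion.mp hz
    have hkn : (k : ℕ) + n ≤ N := kwin (by omega) k
    have : Nonempty ((j : Fin n) × Fin (m (widx hkn j))) := ⟨⟨⟨0, by omega⟩, ⟨0, hm _⟩⟩⟩
    obtain ⟨y, hy, hys⟩ := exists_norm_eq_sval
      (Bplus (triPart a) n k hkn - z • IplusMat m n k hkn)
    have hyε := hys.trans_le hk
    let v : EuclideanSpace ℂ ((i : Fin N) × Fin (m i)) :=
      WithLp.toLp 2 (Function.extend (winEmb hkn) y 0)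
    have hv : ∀ p, p ∉ Set.range (winEmb (m := m) hkn) → v p = 0 := fun p hp =>
      Function.extend_apply' _ _ _ hp
    have hyv : (WithLp.toLp 2 fun q => v (winEmb hkn q)) = y := by
      ext q
      exact (winEmb_injective hkn).extend_apply _ _ _
    have hv1 : ‖v‖ = 1 := by rw [← norm_restrict_eq hkn v hv, hyv, hy]
    rw [← hyv, norm_Bplus_eq hkn _ (triPart_eq_zero a) z v hv] at hyε
    refine sval_le_of_norm_le (x := v) (norm_ne_zero_iff.mp (by simp [hv1])) ?_
    rw [blockMat_eq_triPart_add_remPart, map_add, LinearMap.add_apply, hv1, mul_one]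
    have h1 := norm_toEuclideanLin_le (blockMat m (remPart a)) v
    rw [hv1, mul_one] at h1
    refine (norm_add_le _ _).trans ?_
    linarith
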